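/- Let d = p^n - 3 and assume p^n > 3. The number of quadruples (x₁, x₂, x₃, x₄) of nonzero elements of F = GF(p^n) satisfying x₁ - x₂ + x₃ - x₄ = 0 and x₁^d - x₂^d + x₃^d - x₄^d = 0 equals (p^n - 1)·(3p^n - 8 - 2η(-1) - η(-3)(2 + η(-3)) + λ₂), where λ₂ := ∑_{x ∈ F} η((x²+1)(x²+4x+1)). -/

import Mathlib

open Finset

theorem pow_card_sub_three {F : Type*} [Field F] [Fintype F]
    (h3 : 3 ≤ Fintype.card F) {x : F} (hx : x ≠ 0) :
    x ^ (Fintype.card F - 3) = (x ^ 2)⁻¹ := by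
  refine eq_inv_of_mul_eq_one_left ?_
  rw [← pow_add, show Fintype.card F - 3 + 2 = Fintype.card F - 1 by omega,
    FiniteField.pow_card_sub_one_eq_one x hx]

theorem inv_sq_alternating_sum_eq_zero_iff {F : Type*} [Field F] {a b c e : F}
    (ha : a ≠ 0) (hb : b ≠ 0) (hc : c ≠ 0) (he : e ≠ 0) (hs : a + c = b + e) :
    (a ^ 2)⁻¹ - (b ^ 2)⁻¹ + (c ^ 2)⁻¹ - (e ^ 2)⁻¹ = 0 ↔
      a * c = b * e ∨ (a + c) ^ 2 * (a * c + b * e) = 2 * (a * c) * (b * e) := by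
  have key : (a ^ 2)⁻¹ - (b ^ 2)⁻¹ + (c ^ 2)⁻¹ - (e ^ 2)⁻¹ =
      (b * e - a * c) * ((a + c) ^ 2 * (a * c + b * e) - 2 * (a * c) * (b * e)) /
        (a * b * c * e) ^ 2 := by
    rw [eq_div_iff (by positivity)]
    obtain rfl : b = a + c - e := by linear_combination -hs
    field_simp
    ring
  rw [key, div_eq_zero_iff, mul_eq_zero, sub_eq_zero, sub_eq_zero, eq_comm (a := b * e),
    or_iff_left]
  exact pow_ne_zero 2 (mul_ne_zero (mul_ne_zero (mul_ne_zero ha hb) hc) he)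

section

variable {F : Type*} [Field F] [Fintype F] [DecidableEq F]

theorem card_filter_sq_eq (hF : ringChar F ≠ 2) (a : F) :
    ((univ.filter fun v : F => v ^ 2 = a).card : ℤ) = quadraticChar F a + 1 := by
  rw [← quadraticChar_card_sqrts hF a]
  congr 2
  ext v
  simp

theorem quadraticChar_mul_sq (a : F) {b : F} (hb : b ≠ 0) :
    quadraticChar F (a * b ^ 2) = quadraticChar F a := by
  rw [map_mul, quadraticChar_sq_one' hb, mul_one]

/-- The Möbius substitution `x = (1 - t) / (1 + t)` in the character sum. -/
theorem sum_quadraticChar_palindromic (hF : ringChar F ≠ 2) :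
    ∑ x : F, quadraticChar F ((x ^ 2 + 1) * (x ^ 2 + 4 * x + 1)) =
      quadraticChar F (-1) - 1 + ∑ t : F, quadraticChar F ((3 - t ^ 2) * (1 + t ^ 2)) := by
  have h2 : (2 : F) ≠ 0 := Ring.two_ne_zero hF
  rw [← add_sum_erase univ _ (mem_univ (-1 : F)),
    ← add_sum_erase univ (fun t : F => quadraticChar F ((3 - t ^ 2) * (1 + t ^ 2)))
      (mem_univ (-1 : F))]
  have e1 : quadraticChar F (((-1 : F) ^ 2 + 1) * ((-1) ^ 2 + 4 * (-1) + 1))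
      = quadraticChar F (-1) := by
    rw [← quadraticChar_mul_sq (-1) h2]
    congr 1
    ring
  have e2 : quadraticChar F ((3 - (-1 : F) ^ 2) * (1 + (-1) ^ 2)) = 1 := by
    rw [← quadraticChar_sq_one' h2]
    congr 1
    ring
  have hne : ∀ t : F, t ≠ -1 → 1 + t ≠ 0 := fun t ht h => ht (by linear_combination h)
  have hinv : ∀ t : F, t ≠ -1 →
      1 + (1 - t) / (1 + t) ≠ 0 ∧ (1 - (1 - t) / (1 + t)) / (1 + (1 - t) / (1 + t)) = t := by
    intro t ht
    have h1 := hne t ht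
    have h3 : 1 + (1 - t) / (1 + t) = 2 / (1 + t) := by
      field_simp
      ring
    have h4 : 1 - (1 - t) / (1 + t) = 2 * t / (1 + t) := by
      field_simp
      ring
    rw [h3, h4]
    refine ⟨div_ne_zero h2 h1, ?_⟩
    field_simp
  have hmem : ∀ t : F, t ≠ -1 → (1 - t) / (1 + t) ≠ -1 := fun t ht h =>
    (hinv t ht).1 (by rw [h]; ring)
  have e3 : ∑ x ∈ univ.erase (-1 : F), quadraticChar F ((x ^ 2 + 1) * (x ^ 2 + 4 * x + 1)) =
      ∑ t ∈ univ.erase (-1 : F), quadraticChar F ((3 - t ^ 2) * (1 + t ^ 2)) := by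
    refine sum_nbij' (fun t => (1 - t) / (1 + t)) (fun t => (1 - t) / (1 + t)) ?_ ?_ ?_ ?_ ?_
    · intro t ht
      simpa using hmem t (by simpa using ht)
    · intro t ht
      simpa using hmem t (by simpa using ht)
    · intro t ht
      exact (hinv t (by simpa using ht)).2
    · intro t ht
      exact (hinv t (by simpa using ht)).2
    · intro t ht
      have h1 := hne t (by simpa using ht)
      rw [← quadraticChar_mul_sq _ (div_ne_zero h2 (pow_ne_zero 2 h1))]
      congr 1
      field_simp
      ring
  rw [e1, e2, e3]
  ring

theorem card_filter_one_add_sq_mul (hF : ringChar F ≠ 2) :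
    ((univ.filter fun w : F × F => (1 + w.1 ^ 2) * (1 + w.2 ^ 2) = 4).card : ℤ) =
      Fintype.card F - 1 - quadraticChar F (-1)
        + ∑ u : F, quadraticChar F ((3 - u ^ 2) * (1 + u ^ 2)) := by
  have h2 : (2 : F) ≠ 0 := Ring.two_ne_zero hF
  have h4 : (4 : F) ≠ 0 := by
    rw [show (4 : F) = 2 ^ 2 by norm_num]
    exact pow_ne_zero 2 h2
  have hfib : ∀ u : F, ((univ.filter fun v : F => (1 + u ^ 2) * (1 + v ^ 2) = 4).card : ℤ) =
      1 + quadraticChar F ((3 - u ^ 2) * (1 + u ^ 2)) - if u ^ 2 = -1 then 1 else 0 := by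
    intro u
    split_ifs with hu
    · simp [hu, h4.symm]
    · have hu' : 1 + u ^ 2 ≠ 0 := fun h => hu (by linear_combination h)
      rw [show (3 - u ^ 2) * (1 + u ^ 2) = (3 - u ^ 2) / (1 + u ^ 2) * (1 + u ^ 2) ^ 2 by
        field_simp, quadraticChar_mul_sq _ hu', sub_zero, add_comm (1 : ℤ), ← card_filter_sq_eq hF]
      congr 2
      ext v
      simp only [mem_filter, mem_univ, true_and, eq_div_iff hu']
      constructor <;> intro h <;> linear_combination h
  have hcard : (univ.filter fun w : F × F => (1 + w.1 ^ 2) * (1 + w.2 ^ 2) = 4).card =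
      ∑ u : F, (univ.filter fun v : F => (1 + u ^ 2) * (1 + v ^ 2) = 4).card := by
    simp only [card_filter]
    rw [Fintype.sum_prod_type]
  rw [hcard, Nat.cast_sum, sum_congr rfl fun u _ => hfib u, sum_sub_distrib, sum_add_distrib,
    sum_boole, card_filter_sq_eq hF]
  simp only [sum_const, card_univ, nsmul_eq_mul, mul_one]
  ring

theorem card_filter_one_add_sq_mul_of_ne (hF : ringChar F ≠ 2) :
    ((univ.filter fun w : F × F =>
      (1 + w.1 ^ 2) * (1 + w.2 ^ 2) = 4 ∧ w.1 ^ 2 ≠ w.2 ^ 2).card : ℤ) =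
      (univ.filter fun w : F × F => (1 + w.1 ^ 2) * (1 + w.2 ^ 2) = 4).card - 4
        - (1 + quadraticChar F (-3)) ^ 2 := by
  have h2 : (2 : F) ≠ 0 := Ring.two_ne_zero hF
  have hsplit := card_filter_add_card_filter_not
    (s := univ.filter fun w : F × F => (1 + w.1 ^ 2) * (1 + w.2 ^ 2) = 4)
    (fun w : F × F => w.1 ^ 2 ≠ w.2 ^ 2)
  rw [filter_filter, filter_filter] at hsplit
  have hdiag : (univ.filter fun w : F × F =>
      (1 + w.1 ^ 2) * (1 + w.2 ^ 2) = 4 ∧ ¬ w.1 ^ 2 ≠ w.2 ^ 2) =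
      ((univ.filter fun v : F => v ^ 2 = 1) ×ˢ (univ.filter fun v : F => v ^ 2 = 1)) ∪
      ((univ.filter fun v : F => v ^ 2 = -3) ×ˢ (univ.filter fun v : F => v ^ 2 = -3)) := by
    ext ⟨u, v⟩
    simp only [mem_filter, mem_univ, true_and, mem_union, mem_product, not_not, ne_eq]
    constructor
    · rintro ⟨h, huv⟩
      have h0 : (u ^ 2 - 1) * (u ^ 2 + 3) = 0 := by linear_combination h + (1 + u ^ 2) * huv
      rcases mul_eq_zero.mp h0 with h1 | h1
      · left
        constructor
        · linear_combination h1
        · linear_combination h1 - huv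
      · right
        constructor
        · linear_combination h1
        · linear_combination h1 - huv
    · rintro (⟨h, h'⟩ | ⟨h, h'⟩) <;> rw [h, h'] <;> norm_num
  have hdisj : Disjoint
      ((univ.filter fun v : F => v ^ 2 = 1) ×ˢ (univ.filter fun v : F => v ^ 2 = 1))
      ((univ.filter fun v : F => v ^ 2 = -3) ×ˢ (univ.filter fun v : F => v ^ 2 = -3)) := by
    rw [disjoint_left]
    rintro ⟨u, v⟩ h h'
    simp only [mem_filter, mem_univ, true_and, mem_product] at h h'
    exact pow_ne_zero 2 h2 (by linear_combination h'.1 - h.1)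
  rw [hdiag, card_union_of_disjoint hdisj, card_product, card_product] at hsplit
  have hz := congrArg (Nat.cast : ℕ → ℤ) hsplit
  push_cast at hz
  rw [card_filter_sq_eq hF, card_filter_sq_eq hF, map_one] at hz
  linear_combination hz

theorem card_filter_ne_zero :
    ((univ.filter fun x : F => x ≠ 0).card : ℤ) = Fintype.card F - 1 := by
  rw [filter_ne', card_erase_of_mem (mem_univ _), card_univ, Nat.cast_sub Fintype.card_pos]
  simp

theorem card_filter_add_eq_add_mul_eq_mul :
    ((univ.filter fun t : F × F × F × F =>
      (t.1 ≠ 0 ∧ t.2.1 ≠ 0 ∧ t.2.2.1 ≠ 0 ∧ t.2.2.2 ≠ 0) ∧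
        t.1 + t.2.2.1 = t.2.1 + t.2.2.2 ∧ t.1 * t.2.2.1 = t.2.1 * t.2.2.2).card : ℤ) =
      (Fintype.card F - 1) * (2 * Fintype.card F - 3) := by
  set U : Finset F := univ.filter fun x : F => x ≠ 0 with hU
  have memU : ∀ x, x ∈ U ↔ x ≠ 0 := by simp [hU]
  let A₁ : Finset (F × F × F × F) := (U ×ˢ U).image fun w => (w.1, w.1, w.2, w.2)
  let A₂ : Finset (F × F × F × F) := (U ×ˢ U).image fun w => (w.1, w.2, w.2, w.1)
  have hA : (univ.filter fun t : F × F × F × F =>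
      (t.1 ≠ 0 ∧ t.2.1 ≠ 0 ∧ t.2.2.1 ≠ 0 ∧ t.2.2.2 ≠ 0) ∧
        t.1 + t.2.2.1 = t.2.1 + t.2.2.2 ∧ t.1 * t.2.2.1 = t.2.1 * t.2.2.2) = A₁ ∪ A₂ := by
    ext ⟨a, b, c, e⟩
    simp only [A₁, A₂, mem_filter, mem_univ, true_and, mem_union, mem_image, mem_product, memU,
      Prod.exists, Prod.mk.injEq]
    constructor
    · rintro ⟨⟨ha, hb, hc, he⟩, hs, hp⟩
      have h0 : (a - b) * (a - e) = 0 := by linear_combination a * hs - hp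
      rcases mul_eq_zero.mp h0 with h | h
      · exact Or.inl ⟨a, c, ⟨ha, hc⟩, rfl, by linear_combination h, rfl,
          by linear_combination hs - h⟩
      · exact Or.inr ⟨a, c, ⟨ha, hc⟩, rfl, by linear_combination hs - h, rfl,
          by linear_combination h⟩
    · rintro (⟨x, y, ⟨hx, hy⟩, rfl, rfl, rfl, rfl⟩ | ⟨x, y, ⟨hx, hy⟩, rfl, rfl, rfl, rfl⟩)
      · exact ⟨⟨hx, hx, hy, hy⟩, rfl, rfl⟩
      · exact ⟨⟨hx, hy, hy, hx⟩, add_comm _ _, mul_comm _ _⟩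
  have hI : A₁ ∩ A₂ = U.image fun x => (x, x, x, x) := by
    ext ⟨a, b, c, e⟩
    simp only [A₁, A₂, mem_inter, mem_image, mem_product, memU, Prod.exists, Prod.mk.injEq]
    constructor
    · rintro ⟨⟨x, y, ⟨hx, hy⟩, rfl, rfl, rfl, rfl⟩, ⟨z, w, -, rfl, rfl, h, h'⟩⟩
      exact ⟨_, hx, rfl, rfl, h, h'⟩
    · rintro ⟨x, hx, rfl, rfl, rfl, rfl⟩
      exact ⟨⟨x, x, ⟨hx, hx⟩, rfl, rfl, rfl, rfl⟩, ⟨x, x, ⟨hx, hx⟩, rfl, rfl, rfl, rfl⟩⟩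
  have c₁ : A₁.card = U.card * U.card := by
    rw [← card_product]
    refine card_image_of_injective _ ?_
    rintro ⟨a, b⟩ ⟨c, e⟩ h
    simp_all
  have c₂ : A₂.card = U.card * U.card := by
    rw [← card_product]
    refine card_image_of_injective _ ?_
    rintro ⟨a, b⟩ ⟨c, e⟩ h
    simp_all
  have c₃ : (U.image fun x => (x, x, x, x)).card = U.card := by
    refine card_image_of_injective _ ?_
    intro a b h
    simp_all
  have hc := card_union_add_card_inter A₁ A₂
  rw [hI, c₁, c₂, c₃] at hc
  have hz := congrArg (Nat.cast : ℕ → ℤ) hc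
  push_cast at hz
  rw [hU, card_filter_ne_zero] at hz
  rw [hA]
  linear_combination hz

/-- Scaling by the common value `s` of the half-sums `(x₁ + x₃) / 2 = (x₂ + x₄) / 2` parametrizes
the quadruples with distinct products `x₁ x₃ ≠ x₂ x₄`. -/
theorem card_filter_mul_ne_mul (hF : ringChar F ≠ 2) :
    (univ.filter fun t : F × F × F × F =>
      (t.1 ≠ 0 ∧ t.2.1 ≠ 0 ∧ t.2.2.1 ≠ 0 ∧ t.2.2.2 ≠ 0) ∧
        t.1 + t.2.2.1 = t.2.1 + t.2.2.2 ∧ t.1 * t.2.2.1 ≠ t.2.1 * t.2.2.2 ∧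
        (t.1 + t.2.2.1) ^ 2 * (t.1 * t.2.2.1 + t.2.1 * t.2.2.2) =
          2 * (t.1 * t.2.2.1) * (t.2.1 * t.2.2.2)).card =
      (univ.filter fun x : F => x ≠ 0).card *
        (univ.filter fun w : F × F =>
          (1 + w.1 ^ 2) * (1 + w.2 ^ 2) = 4 ∧ w.1 ^ 2 ≠ w.2 ^ 2).card := by
  have h2 : (2 : F) ≠ 0 := Ring.two_ne_zero hF
  rw [← card_product]
  symm
  refine card_nbij'
    (fun z => (z.1 * (1 + z.2.1), z.1 * (1 + z.2.2), z.1 * (1 - z.2.1), z.1 * (1 - z.2.2)))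
    (fun t => ((t.1 + t.2.2.1) / 2, (t.1 - t.2.2.1) / (t.1 + t.2.2.1),
      (t.2.1 - t.2.2.2) / (t.1 + t.2.2.1))) ?_ ?_ ?_ ?_
  · rintro ⟨s, u, v⟩ h
    simp only [mem_coe, mem_filter, mem_univ, true_and, mem_product] at h ⊢
    obtain ⟨hs, h, huv⟩ := h
    have hu : u ^ 2 ≠ 1 := fun hu => huv (mul_left_cancel₀ h2 (by
      linear_combination (2 + (1 + v ^ 2)) * hu - h))
    have hv : v ^ 2 ≠ 1 := fun hv => huv (mul_left_cancel₀ h2 (by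
      linear_combination h - (2 + (1 + u ^ 2)) * hv))
    refine ⟨⟨mul_ne_zero hs fun h' => hu ?_, mul_ne_zero hs fun h' => hv ?_,
      mul_ne_zero hs fun h' => hu ?_, mul_ne_zero hs fun h' => hv ?_⟩, by ring, ?_, ?_⟩
    · linear_combination (u - 1) * h'
    · linear_combination (v - 1) * h'
    · linear_combination -(u + 1) * h'
    · linear_combination -(v + 1) * h'
    · intro h'
      refine huv (mul_left_cancel₀ (pow_ne_zero 2 hs) ?_)
      linear_combination -h'
    · linear_combination -2 * s ^ 4 * h
  · rintro ⟨a, b, c, e⟩ h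
    simp only [mem_coe, mem_filter, mem_univ, true_and, mem_product] at h ⊢
    obtain ⟨⟨ha, hb, hc, he⟩, hs, hP, h⟩ := h
    have hS : a + c ≠ 0 := by
      intro hS
      rw [hS] at h
      have : 2 * (a * c) * (b * e) ≠ 0 :=
        mul_ne_zero (mul_ne_zero h2 (mul_ne_zero ha hc)) (mul_ne_zero hb he)
      exact this (by linear_combination -h)
    refine ⟨div_ne_zero hS h2, ?_, ?_⟩
    · obtain rfl : b = a + c - e := by linear_combination -hs
      field_simp
      linear_combination -8 * h
    · intro h'
      rw [div_pow, div_pow, div_left_inj' (pow_ne_zero 2 hS)] at h'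
      refine hP (mul_left_cancel₀ (mul_ne_zero h2 h2) ?_)
      linear_combination (a + c + b + e) * hs - h'
  · rintro ⟨s, u, v⟩ h
    simp only [mem_coe, mem_filter, mem_univ, true_and, mem_product] at h
    have hs := h.1
    have e1 : s * (1 + u) + s * (1 - u) = 2 * s := by ring
    have e2 : s * (1 + u) - s * (1 - u) = 2 * s * u := by ring
    have e3 : s * (1 + v) - s * (1 - v) = 2 * s * v := by ring
    simp only [e1, e2, e3, Prod.mk.injEq]
    refine ⟨?_, ?_, ?_⟩ <;> field_simp
  · rintro ⟨a, b, c, e⟩ h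
    simp only [mem_coe, mem_filter, mem_univ, true_and] at h
    obtain ⟨⟨ha, hb, hc, he⟩, hs, hP, h⟩ := h
    have hS : a + c ≠ 0 := by
      intro hS
      rw [hS] at h
      have : 2 * (a * c) * (b * e) ≠ 0 :=
        mul_ne_zero (mul_ne_zero h2 (mul_ne_zero ha hc)) (mul_ne_zero hb he)
      exact this (by linear_combination -h)
    simp only [Prod.mk.injEq]
    obtain rfl : b = a + c - e := by linear_combination -hs
    refine ⟨?_, ?_, ?_, ?_⟩ <;> field_simp <;> ring

theorem card_filter_pow_card_sub_three (hF : ringChar F ≠ 2) (h3 : 3 ≤ Fintype.card F) :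
    ((univ.filter
      (fun t : F × F × F × F => t.1 ≠ 0 ∧ t.2.1 ≠ 0 ∧ t.2.2.1 ≠ 0 ∧ t.2.2.2 ≠ 0 ∧
        t.1 - t.2.1 + t.2.2.1 - t.2.2.2 = 0 ∧
        t.1 ^ (Fintype.card F - 3) - t.2.1 ^ (Fintype.card F - 3)
          + t.2.2.1 ^ (Fintype.card F - 3) - t.2.2.2 ^ (Fintype.card F - 3) = 0)).card : ℤ) =
      (Fintype.card F - 1) * (3 * Fintype.card F - 8 - 2 * quadraticChar F (-1)
        - quadraticChar F (-3) * (2 + quadraticChar F (-3))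
        + ∑ x : F, quadraticChar F ((x ^ 2 + 1) * (x ^ 2 + 4 * x + 1))) := by
  have hT : (univ.filter
      (fun t : F × F × F × F => t.1 ≠ 0 ∧ t.2.1 ≠ 0 ∧ t.2.2.1 ≠ 0 ∧ t.2.2.2 ≠ 0 ∧
        t.1 - t.2.1 + t.2.2.1 - t.2.2.2 = 0 ∧
        t.1 ^ (Fintype.card F - 3) - t.2.1 ^ (Fintype.card F - 3)
          + t.2.2.1 ^ (Fintype.card F - 3) - t.2.2.2 ^ (Fintype.card F - 3) = 0)) =
      (univ.filter fun t : F × F × F × F =>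
        (t.1 ≠ 0 ∧ t.2.1 ≠ 0 ∧ t.2.2.1 ≠ 0 ∧ t.2.2.2 ≠ 0) ∧
          t.1 + t.2.2.1 = t.2.1 + t.2.2.2 ∧ t.1 * t.2.2.1 = t.2.1 * t.2.2.2) ∪
      (univ.filter fun t : F × F × F × F =>
        (t.1 ≠ 0 ∧ t.2.1 ≠ 0 ∧ t.2.2.1 ≠ 0 ∧ t.2.2.2 ≠ 0) ∧
          t.1 + t.2.2.1 = t.2.1 + t.2.2.2 ∧ t.1 * t.2.2.1 ≠ t.2.1 * t.2.2.2 ∧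
          (t.1 + t.2.2.1) ^ 2 * (t.1 * t.2.2.1 + t.2.1 * t.2.2.2) =
            2 * (t.1 * t.2.2.1) * (t.2.1 * t.2.2.2)) := by
    ext ⟨a, b, c, e⟩
    simp only [mem_filter, mem_univ, true_and, mem_union]
    have hsum : a - b + c - e = 0 ↔ a + c = b + e := by
      constructor <;> intro h <;> linear_combination h
    rw [hsum]
    by_cases h0 : a ≠ 0 ∧ b ≠ 0 ∧ c ≠ 0 ∧ e ≠ 0
    · obtain ⟨ha, hb, hc, he⟩ := h0
      rw [pow_card_sub_three h3 ha, pow_card_sub_three h3 hb, pow_card_sub_three h3 hc,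
        pow_card_sub_three h3 he]
      by_cases hs : a + c = b + e
      · rw [inv_sq_alternating_sum_eq_zero_iff ha hb hc he hs]
        tauto
      · tauto
    · tauto
  rw [hT, card_union_of_disjoint, Nat.cast_add, card_filter_add_eq_add_mul_eq_mul,
    card_filter_mul_ne_mul hF, Nat.cast_mul, card_filter_ne_zero,
    card_filter_one_add_sq_mul_of_ne hF, card_filter_one_add_sq_mul hF,
    sum_quadraticChar_palindromic hF]
  · ring
  · rw [disjoint_left]
    intro t h h'
    simp only [mem_filter, mem_univ, true_and] at h h'
    exact h'.2.2.1 h.2.2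

theorem eq_quadraticChar {η : F → ℤ} (hη0 : η 0 = 0)
    (hη1 : ∀ x : F, x ≠ 0 → IsSquare x → η x = 1)
    (hη2 : ∀ x : F, ¬ IsSquare x → η x = -1) (x : F) : η x = quadraticChar F x := by
  rw [quadraticChar_apply, quadraticCharFun]
  split_ifs with h h'
  · rw [h, hη0]
  · exact hη1 x h h'
  · exact hη2 x h'

end


/-- With `d = p^n - 3` and `p^n > 3`, the number of quadruples of nonzero
elements `(x₁,x₂,x₃,x₄)` of `F = GF(p^n)` with `x₁ - x₂ + x₃ - x₄ = 0` and
`x₁^d - x₂^d + x₃^d - x₄^d = 0` equals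
`(p^n - 1)(3p^n - 8 - 2η(-1) - η(-3)(2 + η(-3)) + λ₂)`, where
`λ₂ = ∑_{x ∈ F} η((x²+1)(x²+4x+1))`. -/
theorem stmt_8 (p n : ℕ) (hp : p.Prime) (hp2 : p ≠ 2) (hn : 0 < n)
    (F : Type*) [Field F] [Fintype F] [DecidableEq F]
    (hF : Fintype.card F = p ^ n)
    (hq : 3 < p ^ n)
    (η : F → ℤ)
    (hη0 : η 0 = 0)
    (hη1 : ∀ x : F, x ≠ 0 → IsSquare x → η x = 1)
    (hη2 : ∀ x : F, ¬ IsSquare x → η x = -1) :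
    ((Finset.univ.filter
      (fun t : F × F × F × F => t.1 ≠ 0 ∧ t.2.1 ≠ 0 ∧ t.2.2.1 ≠ 0 ∧ t.2.2.2 ≠ 0 ∧
        t.1 - t.2.1 + t.2.2.1 - t.2.2.2 = 0 ∧
        t.1 ^ (p ^ n - 3) - t.2.1 ^ (p ^ n - 3) + t.2.2.1 ^ (p ^ n - 3)
          - t.2.2.2 ^ (p ^ n - 3) = 0)).card : ℤ) =
      ((p : ℤ) ^ n - 1) * (3 * (p : ℤ) ^ n - 8 - 2 * η (-1) - η (-3) * (2 + η (-3))
        + ∑ x : F, η ((x ^ 2 + 1) * (x ^ 2 + 4 * x + 1))) := by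
  have hp' : Fact p.Prime := ⟨hp⟩
  have hchar : ringChar F ≠ 2 := by
    intro h
    have h2 : Fintype.card F % 2 = 0 := FiniteField.even_card_of_char_two h
    rw [hF] at h2
    exact hp2 ((Nat.prime_dvd_prime_iff_eq Nat.prime_two hp).mp
      (Nat.prime_two.dvd_of_dvd_pow (Nat.dvd_of_mod_eq_zero h2))).symm
  have h := card_filter_pow_card_sub_three hchar (by omega)
  simp only [eq_quadraticChar hη0 hη1 hη2]
  rw [hF] at h
  exact_mod_cast h
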